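/- Let 1 < β ≤ 2 and 1 < γ ≤ 2, let M₁, M₂ ≥ 2 be integers, and let μ₀, K₁, K₂, ν_β, ν_γ > 0. Define the linear operator 𝓛 on real (M₁−1)×(M₂−1) matrices by 𝓛(U) = (μ₀·I + K₁·ν_β·G_β)·U + U·(K₂·ν_γ·G_γ). Then 𝓛 is symmetric positive definite with respect to the Frobenius inner product ⟨X,Y⟩_F = trace(Xᵀ·Y); that is, ⟨𝓛(U), V⟩_F = ⟨U, 𝓛(V)⟩_F for all U, V, and ⟨𝓛(U), U⟩_F > 0 for every nonzero U. -/

import Mathlib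

/-- Fractional centered difference coefficients `ĝ_k^{(β)}`. -/
noncomputable def ghat (β : ℝ) (k : ℤ) : ℝ :=
  (-1 : ℝ) ^ k * Real.Gamma (β + 1) /
    (Real.Gamma (β / 2 - k + 1) * Real.Gamma (β / 2 + k + 1))

/-- The `(M−1)×(M−1)` symmetric Toeplitz matrix `G_β`. -/
noncomputable def Gmat (β : ℝ) (M : ℕ) : Matrix (Fin (M - 1)) (Fin (M - 1)) ℝ :=
  Matrix.of fun i j => ghat β ((i : ℤ) - (j : ℤ))

/-- First column of the circulant approximation `r(G_β)`. -/
noncomputable def rcol (β : ℝ) (M : ℕ) (k : ℕ) : ℝ :=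
  if k = 0 then ghat β 0 else ghat β k + ghat β ((k : ℤ) - ((M : ℤ) - 1))

/-- The `(M−1)×(M−1)` circulant matrix `r(G_β)`. -/
noncomputable def circG (β : ℝ) (M : ℕ) : Matrix (Fin (M - 1)) (Fin (M - 1)) ℝ :=
  Matrix.of fun i j => rcol β M ((((i : ℤ) - (j : ℤ)) % ((M : ℤ) - 1)).toNat)

/-- The constant `c_*^{(β)} = (2/β) r_β`. -/
noncomputable def cstar (β : ℝ) : ℝ :=
  (2 / β) * (Real.exp (-2) * ((4 - β) * (2 - β) * β) / ((6 + β) * (4 + β) * (2 + β)) *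
    (Real.Gamma (β + 1) / (Real.Gamma (β / 2 + 1)) ^ 2) * (3 + β / 2) ^ (β + 1))

/-- Grünwald coefficients `g_k^{(γ)}`. -/
noncomputable def gcoef (γ : ℝ) : ℕ → ℝ
  | 0 => 1
  | (k + 1) => (1 - (γ + 1) / (k + 1)) * gcoef γ k

/-- Weighted and shifted Grünwald coefficients `λ_k^{(γ)}`. -/
noncomputable def lamc (γ : ℝ) : ℕ → ℝ
  | 0 => 1 + γ / 2
  | (k + 1) => (1 + γ / 2) * gcoef γ (k + 1) - (γ / 2) * gcoef γ k

theorem ghat_neg (β : ℝ) (k : ℤ) : ghat β (-k) = ghat β k := by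
  unfold ghat
  have h : ((-1 : ℝ)) ^ (-k) = (-1) ^ k := by
    rw [zpow_neg, ← inv_zpow]; norm_num
  rw [h]
  push_cast
  rw [sub_neg_eq_add, ← sub_eq_add_neg, mul_comm (Real.Gamma (β / 2 - k + 1))]

theorem ghat_rec (β : ℝ) (hβ : 0 < β) (k : ℕ) :
    (k + 1 + β / 2) * ghat β ((k + 1 : ℕ) : ℤ) = (k - β / 2) * ghat β (k : ℤ) := by
  have hk : (0 : ℝ) ≤ k := Nat.cast_nonneg k
  have h1 : Real.Gamma (β / 2 + k + 1 + 1) = (β / 2 + k + 1) * Real.Gamma (β / 2 + k + 1) :=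
    Real.Gamma_add_one (by positivity)
  have hpos : 0 < Real.Gamma (β / 2 + k + 1) := Real.Gamma_pos_of_pos (by positivity)
  have e1 : β / 2 + ((k : ℝ) + 1) + 1 = β / 2 + k + 1 + 1 := by ring
  have e2 : β / 2 - ((k : ℝ) + 1) + 1 = β / 2 - k := by ring
  unfold ghat
  push_cast
  rw [e1, e2, h1, zpow_add₀ (by norm_num), zpow_natCast, zpow_one]
  by_cases h0 : β / 2 - k = 0
  · rw [h0, Real.Gamma_zero, show (k : ℝ) - β / 2 = 0 by linarith]
    simp
  · have h2 : Real.Gamma (β / 2 - k + 1) = (β / 2 - k) * Real.Gamma (β / 2 - k) :=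
      Real.Gamma_add_one h0
    rw [h2]
    by_cases h3 : Real.Gamma (β / 2 - k) = 0
    · rw [h3]; simp
    · have h4 : β / 2 + k + 1 ≠ 0 := by positivity
      have h5 : (k : ℝ) + 1 + β / 2 = β / 2 + k + 1 := by ring
      have h6 : (k : ℝ) - β / 2 = -(β / 2 - k) := by ring
      rw [h5, h6]
      have hne := hpos.ne'
      generalize Real.Gamma (β / 2 - k) = A at *
      generalize Real.Gamma (β / 2 + k + 1) = B at *
      generalize Real.Gamma (β + 1) = C at *
      generalize β / 2 - (k : ℝ) = d at *
      generalize β / 2 + (k : ℝ) + 1 = c at *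
      field_simp

theorem ghat_zero_pos (β : ℝ) (hβ : 0 < β) : 0 < ghat β 0 := by
  unfold ghat
  have h1 : 0 < Real.Gamma (β + 1) := Real.Gamma_pos_of_pos (by positivity)
  have h2 : 0 < Real.Gamma (β / 2 + 1) := Real.Gamma_pos_of_pos (by positivity)
  simp only [Int.cast_zero, sub_zero, add_zero, zpow_zero, one_mul]
  positivity

theorem ghat_succ_nonpos (β : ℝ) (hβ : 0 < β) (hβ2 : β ≤ 2) (k : ℕ) :
    ghat β ((k + 1 : ℕ) : ℤ) ≤ 0 := by
  induction k with
  | zero =>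
    have h := ghat_rec β hβ 0
    have h0 := ghat_zero_pos β hβ
    push_cast at h ⊢
    by_contra hc
    push Not at hc
    have : 0 < (0 + 1 + β / 2) * ghat β (0 + 1) := by positivity
    nlinarith
  | succ n ih =>
    have h := ghat_rec β hβ (n + 1)
    by_contra hc
    push Not at hc
    have hn : (0 : ℝ) ≤ n := Nat.cast_nonneg n
    have h5 : 0 < (((n + 1 : ℕ) : ℝ) + 1 + β / 2) * ghat β ((n + 1 + 1 : ℕ) : ℤ) := by positivity
    have h6 : 0 ≤ ((n + 1 : ℕ) : ℝ) - β / 2 := by push_cast; linarith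
    have h7 := mul_nonpos_of_nonneg_of_nonpos h6 ih
    linarith

/-- Closed form of the symmetric partial sums. -/
theorem ghat_partial (β : ℝ) (hβ : 0 < β) (n : ℕ) :
    β / 2 * (ghat β 0 + 2 * ∑ k ∈ Finset.range n, ghat β ((k + 1 : ℕ) : ℤ))
      = (β / 2 - n) * ghat β (n : ℤ) := by
  induction n with
  | zero => simp
  | succ n ih =>
    rw [Finset.sum_range_succ]
    have h := ghat_rec β hβ n
    push_cast at h ih ⊢
    linarith

theorem ghat_partial_nonneg (β : ℝ) (hβ : 0 < β) (hβ2 : β ≤ 2) (n : ℕ) :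
    0 ≤ ghat β 0 + 2 * ∑ k ∈ Finset.range n, ghat β ((k + 1 : ℕ) : ℤ) := by
  cases n with
  | zero => simpa using (ghat_zero_pos β hβ).le
  | succ n =>
    have h := ghat_partial β hβ (n + 1)
    have h1 := ghat_succ_nonpos β hβ hβ2 n
    have hn : (0 : ℝ) ≤ n := Nat.cast_nonneg n
    have h2 : 0 ≤ (β / 2 - (n + 1 : ℕ)) * ghat β ((n + 1 : ℕ) : ℤ) :=
      mul_nonneg_of_nonpos_of_nonpos (by push_cast; linarith) h1
    rw [← h] at h2
    exact nonneg_of_mul_nonneg_right h2 (by positivity)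

theorem ghat_row (β : ℝ) (i m : ℕ) :
    2 * ∑ j ∈ Finset.range (i + 1 + m), ghat β ((i : ℤ) - (j : ℤ))
      = (ghat β 0 + 2 * ∑ k ∈ Finset.range i, ghat β ((k + 1 : ℕ) : ℤ))
        + (ghat β 0 + 2 * ∑ k ∈ Finset.range m, ghat β ((k + 1 : ℕ) : ℤ)) := by
  have h1 : ∑ j ∈ Finset.range (i + 1), ghat β ((i : ℤ) - (j : ℤ))
      = ∑ k ∈ Finset.range (i + 1), ghat β (k : ℤ) := by
    rw [← Finset.sum_range_reflect]
    refine Finset.sum_congr rfl fun k hk => ?_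
    have := Finset.mem_range.1 hk
    congr 1
    omega
  have h2 : ∑ j ∈ Finset.range m, ghat β ((i : ℤ) - ((i + 1 + j : ℕ) : ℤ))
      = ∑ k ∈ Finset.range m, ghat β ((k + 1 : ℕ) : ℤ) := by
    refine Finset.sum_congr rfl fun k _ => ?_
    rw [← ghat_neg]
    congr 1
    push_cast
    ring
  rw [Finset.sum_range_add, h1, h2, Finset.sum_range_succ']
  push_cast
  ring

theorem ghat_row_nonneg (β : ℝ) (hβ : 0 < β) (hβ2 : β ≤ 2) (N : ℕ) (i : Fin N) :
    0 ≤ ∑ j : Fin N, ghat β ((i : ℤ) - (j : ℤ)) := by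
  rw [Fin.sum_univ_eq_sum_range (fun j : ℕ => ghat β (((i : ℕ) : ℤ) - (j : ℤ))) N]
  obtain ⟨m, hm⟩ : ∃ m, N = (i : ℕ) + 1 + m := ⟨N - (i + 1), by omega⟩
  have h := ghat_row β i m
  rw [← hm] at h
  have h1 := ghat_partial_nonneg β hβ hβ2 i
  have h2 := ghat_partial_nonneg β hβ hβ2 m
  linarith

theorem ghat_ne_nonpos (β : ℝ) (hβ : 0 < β) (hβ2 : β ≤ 2) (k : ℤ) (hk : k ≠ 0) :
    ghat β k ≤ 0 := by
  have key : ∀ n : ℕ, n ≠ 0 → ghat β (n : ℤ) ≤ 0 := by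
    intro n hn
    obtain ⟨m, rfl⟩ := Nat.exists_eq_succ_of_ne_zero hn
    exact ghat_succ_nonpos β hβ hβ2 m
  rcases Int.natAbs_eq k with h | h
  · rw [h]; exact key _ (by omega)
  · rw [h, ghat_neg]; exact key _ (by omega)

theorem Gmat_symm (β : ℝ) (M : ℕ) : (Gmat β M).transpose = Gmat β M := by
  ext i j
  simp only [Gmat, Matrix.transpose_apply, Matrix.of_apply]
  rw [← ghat_neg, neg_sub]

theorem Gmat_posSemidef (β : ℝ) (hβ : 0 < β) (hβ2 : β ≤ 2) (M : ℕ) :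
    (Gmat β M).PosSemidef := by
  refine Matrix.PosSemidef.of_dotProduct_mulVec_nonneg ?_ ?_
  · rw [Matrix.IsHermitian, Matrix.conjTranspose_eq_transpose_of_trivial, Gmat_symm]
  · intro x
    have e : star x ⬝ᵥ (Gmat β M).mulVec x
        = ∑ i : Fin (M - 1), ∑ j : Fin (M - 1), ghat β ((i : ℤ) - (j : ℤ)) * (x i * x j) := by
      simp only [dotProduct, Matrix.mulVec, Gmat, Matrix.of_apply, Finset.mul_sum, star_trivial]
      refine Finset.sum_congr rfl fun i _ => Finset.sum_congr rfl fun j _ => by ring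
    rw [e]
    have h1 : ∑ i : Fin (M - 1), ∑ j : Fin (M - 1),
          ghat β ((i : ℤ) - (j : ℤ)) * ((x i ^ 2 + x j ^ 2) / 2)
        ≤ ∑ i : Fin (M - 1), ∑ j : Fin (M - 1), ghat β ((i : ℤ) - (j : ℤ)) * (x i * x j) := by
      refine Finset.sum_le_sum fun i _ => Finset.sum_le_sum fun j _ => ?_
      by_cases hij : i = j
      · subst hij
        apply le_of_eq
        ring
      · have := ghat_ne_nonpos β hβ hβ2 ((i : ℤ) - (j : ℤ)) (by
          intro h; apply hij; ext; omega)
        nlinarith [sq_nonneg (x i - x j)]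
    have h2 : ∑ i : Fin (M - 1), ∑ j : Fin (M - 1), ghat β ((i : ℤ) - (j : ℤ)) * x j ^ 2
        = ∑ i : Fin (M - 1), ∑ j : Fin (M - 1), ghat β ((i : ℤ) - (j : ℤ)) * x i ^ 2 := by
      rw [Finset.sum_comm]
      refine Finset.sum_congr rfl fun i _ => Finset.sum_congr rfl fun j _ => ?_
      rw [← ghat_neg, neg_sub]
    have h3 : ∑ i : Fin (M - 1), ∑ j : Fin (M - 1),
          ghat β ((i : ℤ) - (j : ℤ)) * ((x i ^ 2 + x j ^ 2) / 2)
        = ((∑ i : Fin (M - 1), ∑ j : Fin (M - 1), ghat β ((i : ℤ) - (j : ℤ)) * x i ^ 2)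
          + ∑ i : Fin (M - 1), ∑ j : Fin (M - 1), ghat β ((i : ℤ) - (j : ℤ)) * x j ^ 2) / 2 := by
      simp only [← Finset.sum_add_distrib, Finset.sum_div]
      refine Finset.sum_congr rfl fun i _ => Finset.sum_congr rfl fun j _ => by ring
    have h4 : 0 ≤ ∑ i : Fin (M - 1), ∑ j : Fin (M - 1),
        ghat β ((i : ℤ) - (j : ℤ)) * x i ^ 2 := by
      refine Finset.sum_nonneg fun i _ => ?_
      rw [← Finset.sum_mul]
      exact mul_nonneg (ghat_row_nonneg β hβ hβ2 _ i) (sq_nonneg _)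
    linarith

open Matrix in
/-- the Sylvester operator `𝓛(U) = (μ₀ I + K₁ ν_β G_β) U + U (K₂ ν_γ G_γ)`
is symmetric positive definite w.r.t. the Frobenius inner product. -/
theorem stmt7 (β γ : ℝ) (hβ1 : 1 < β) (hβ2 : β ≤ 2) (hγ1 : 1 < γ) (hγ2 : γ ≤ 2)
    (M₁ M₂ : ℕ) (hM₁ : 2 ≤ M₁) (hM₂ : 2 ≤ M₂)
    (μ₀ K₁ K₂ νβ νγ : ℝ) (hμ : 0 < μ₀) (hK₁ : 0 < K₁) (hK₂ : 0 < K₂)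
    (hνβ : 0 < νβ) (hνγ : 0 < νγ) :
    let L : Matrix (Fin (M₁ - 1)) (Fin (M₂ - 1)) ℝ → Matrix (Fin (M₁ - 1)) (Fin (M₂ - 1)) ℝ :=
      fun U =>
        (μ₀ • (1 : Matrix (Fin (M₁ - 1)) (Fin (M₁ - 1)) ℝ) + (K₁ * νβ) • Gmat β M₁) * U +
          U * ((K₂ * νγ) • Gmat γ M₂)
    (∀ U V : Matrix (Fin (M₁ - 1)) (Fin (M₂ - 1)) ℝ,
        ((L U)ᵀ * V).trace = (Uᵀ * L V).trace) ∧
    ∀ U : Matrix (Fin (M₁ - 1)) (Fin (M₂ - 1)) ℝ, U ≠ 0 → 0 < ((L U)ᵀ * U).trace := by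
  intro L
  have hA := Gmat_symm β M₁
  have hB := Gmat_symm γ M₂
  constructor
  · intro U V
    simp only [L, transpose_add, transpose_mul, transpose_smul, transpose_one, hA, hB,
      Matrix.add_mul, Matrix.mul_add, trace_add, Matrix.mul_assoc]
    congr 1
    rw [trace_mul_comm, Matrix.mul_assoc]
  · intro U hU
    have e : ((L U)ᵀ * U).trace = μ₀ * (Uᴴ * U).trace
        + (K₁ * νβ) * (Uᴴ * Gmat β M₁ * U).trace
        + (K₂ * νγ) * (U * Gmat γ M₂ * Uᴴ).trace := by
      have hc : (U * Gmat γ M₂ * Uᴴ).trace = (Gmat γ M₂ * (Uᵀ * U)).trace := by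
        rw [conjTranspose_eq_transpose_of_trivial, Matrix.mul_assoc, trace_mul_comm,
          Matrix.mul_assoc]
      rw [hc]
      simp only [L, conjTranspose_eq_transpose_of_trivial,
        transpose_add, transpose_mul, transpose_smul, transpose_one, hA, hB,
        Matrix.add_mul, Matrix.mul_add, trace_add, Matrix.mul_assoc, Matrix.smul_mul,
        Matrix.mul_smul, trace_smul, Matrix.one_mul, Matrix.mul_one, smul_eq_mul]
    rw [e]
    have p1 := ((Gmat_posSemidef β (by linarith) hβ2 M₁).conjTranspose_mul_mul_same U).trace_nonneg
    have p2 := ((Gmat_posSemidef γ (by linarith) hγ2 M₂).mul_mul_conjTranspose_same U).trace_nonneg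
    have p3 := (posSemidef_conjTranspose_mul_self U).trace_nonneg
    have p4 : (Uᴴ * U).trace ≠ 0 := fun h => hU (trace_conjTranspose_mul_self_eq_zero_iff.1 h)
    have p5 : 0 < (Uᴴ * U).trace := lt_of_le_of_ne p3 p4.symm
    positivity
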